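/- Suppose A₀ and A₁ are jointly negative definite, i.e., there exists μ₁ ∈ ℝ such that A₀ + μ₁A₁ is negative definite. Then the problem (GTR) has at most one local-nonglobal minimizer. -/

import Mathlib

open Matrix Finset

/-- Euclidean norm of a vector in `Fin n → ℝ`. -/
noncomputable def euclNorm {n : ℕ} (x : Fin n → ℝ) : ℝ := Real.sqrt (x ⬝ᵥ x)

/-- Objective `f₀(x) = xᵀA₀x + 2b₀ᵀx`. -/
noncomputable def qf0 {n : ℕ} (A0 : Matrix (Fin n) (Fin n) ℝ) (b0 : Fin n → ℝ)
    (x : Fin n → ℝ) : ℝ := x ⬝ᵥ A0.mulVec x + 2 * (b0 ⬝ᵥ x)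

/-- Constraint `f₁(x) = xᵀA₁x + 2b₁ᵀx + c₁`. -/
noncomputable def qf1 {n : ℕ} (A1 : Matrix (Fin n) (Fin n) ℝ) (b1 : Fin n → ℝ) (c1 : ℝ)
    (x : Fin n → ℝ) : ℝ := x ⬝ᵥ A1.mulVec x + 2 * (b1 ⬝ᵥ x) + c1

/-- Local minimizer of (GTRE): feasible, and locally optimal among feasible points. -/
def IsLocalMinGTRE {n : ℕ} (A0 A1 : Matrix (Fin n) (Fin n) ℝ) (b0 b1 : Fin n → ℝ) (c1 : ℝ)
    (xs : Fin n → ℝ) : Prop :=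
  qf1 A1 b1 c1 xs = 0 ∧ ∃ δ > (0:ℝ), ∀ x : Fin n → ℝ,
    qf1 A1 b1 c1 x = 0 → euclNorm (x - xs) < δ → qf0 A0 b0 xs ≤ qf0 A0 b0 x

/-- Global minimizer of (GTRE). -/
def IsGlobalMinGTRE {n : ℕ} (A0 A1 : Matrix (Fin n) (Fin n) ℝ) (b0 b1 : Fin n → ℝ) (c1 : ℝ)
    (xs : Fin n → ℝ) : Prop :=
  qf1 A1 b1 c1 xs = 0 ∧ ∀ x : Fin n → ℝ, qf1 A1 b1 c1 x = 0 → qf0 A0 b0 xs ≤ qf0 A0 b0 x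

/-- Local-nonglobal minimizer of (GTRE). -/
def IsLNGMinGTRE {n : ℕ} (A0 A1 : Matrix (Fin n) (Fin n) ℝ) (b0 b1 : Fin n → ℝ) (c1 : ℝ)
    (xs : Fin n → ℝ) : Prop :=
  IsLocalMinGTRE A0 A1 b0 b1 c1 xs ∧ ¬ IsGlobalMinGTRE A0 A1 b0 b1 c1 xs

/-- Strict local minimizer of (GTRE). -/
def IsStrictLocalMinGTRE {n : ℕ} (A0 A1 : Matrix (Fin n) (Fin n) ℝ) (b0 b1 : Fin n → ℝ)
    (c1 : ℝ) (xs : Fin n → ℝ) : Prop :=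
  qf1 A1 b1 c1 xs = 0 ∧ ∃ δ > (0:ℝ), ∀ x : Fin n → ℝ,
    qf1 A1 b1 c1 x = 0 → x ≠ xs → euclNorm (x - xs) < δ → qf0 A0 b0 xs < qf0 A0 b0 x

/-- Strict local-nonglobal minimizer of (GTRE). -/
def IsStrictLNGMinGTRE {n : ℕ} (A0 A1 : Matrix (Fin n) (Fin n) ℝ) (b0 b1 : Fin n → ℝ)
    (c1 : ℝ) (xs : Fin n → ℝ) : Prop :=
  IsStrictLocalMinGTRE A0 A1 b0 b1 c1 xs ∧ ¬ IsGlobalMinGTRE A0 A1 b0 b1 c1 xs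

/-- Local minimizer of (GTR). -/
def IsLocalMinGTR {n : ℕ} (A0 A1 : Matrix (Fin n) (Fin n) ℝ) (b0 b1 : Fin n → ℝ) (c1 : ℝ)
    (xs : Fin n → ℝ) : Prop :=
  qf1 A1 b1 c1 xs ≤ 0 ∧ ∃ δ > (0:ℝ), ∀ x : Fin n → ℝ,
    qf1 A1 b1 c1 x ≤ 0 → euclNorm (x - xs) < δ → qf0 A0 b0 xs ≤ qf0 A0 b0 x

/-- Global minimizer of (GTR). -/
def IsGlobalMinGTR {n : ℕ} (A0 A1 : Matrix (Fin n) (Fin n) ℝ) (b0 b1 : Fin n → ℝ) (c1 : ℝ)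
    (xs : Fin n → ℝ) : Prop :=
  qf1 A1 b1 c1 xs ≤ 0 ∧ ∀ x : Fin n → ℝ, qf1 A1 b1 c1 x ≤ 0 → qf0 A0 b0 xs ≤ qf0 A0 b0 x

/-- Local-nonglobal minimizer of (GTR). -/
def IsLNGMinGTR {n : ℕ} (A0 A1 : Matrix (Fin n) (Fin n) ℝ) (b0 b1 : Fin n → ℝ) (c1 : ℝ)
    (xs : Fin n → ℝ) : Prop :=
  IsLocalMinGTR A0 A1 b0 b1 c1 xs ∧ ¬ IsGlobalMinGTR A0 A1 b0 b1 c1 xs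

/-- Strict local minimizer of (GTR). -/
def IsStrictLocalMinGTR {n : ℕ} (A0 A1 : Matrix (Fin n) (Fin n) ℝ) (b0 b1 : Fin n → ℝ)
    (c1 : ℝ) (xs : Fin n → ℝ) : Prop :=
  qf1 A1 b1 c1 xs ≤ 0 ∧ ∃ δ > (0:ℝ), ∀ x : Fin n → ℝ,
    qf1 A1 b1 c1 x ≤ 0 → x ≠ xs → euclNorm (x - xs) < δ → qf0 A0 b0 xs < qf0 A0 b0 x

/-- Strict local-nonglobal minimizer of (GTR). -/
def IsStrictLNGMinGTR {n : ℕ} (A0 A1 : Matrix (Fin n) (Fin n) ℝ) (b0 b1 : Fin n → ℝ)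
    (c1 : ℝ) (xs : Fin n → ℝ) : Prop :=
  IsStrictLocalMinGTR A0 A1 b0 b1 c1 xs ∧ ¬ IsGlobalMinGTR A0 A1 b0 b1 c1 xs

open Topology Filter

section QuadraticForms

variable {n : ℕ}

lemma dotProduct_mulVec_symm {A : Matrix (Fin n) (Fin n) ℝ} (hA : A.IsSymm)
    (u v : Fin n → ℝ) : u ⬝ᵥ A *ᵥ v = v ⬝ᵥ A *ᵥ u := by
  rw [dotProduct_mulVec, ← mulVec_transpose, hA.eq, dotProduct_comm]

/-- Expansion of a quadratic form on a linear combination of two vectors. -/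
lemma quadForm_comb {A : Matrix (Fin n) (Fin n) ℝ} (hA : A.IsSymm) (s t : ℝ)
    (u v : Fin n → ℝ) :
    (s • u + t • v) ⬝ᵥ A *ᵥ (s • u + t • v) =
      s ^ 2 * (u ⬝ᵥ A *ᵥ u) + 2 * s * t * (u ⬝ᵥ A *ᵥ v) + t ^ 2 * (v ⬝ᵥ A *ᵥ v) := by
  simp only [mulVec_add, mulVec_smul, dotProduct_add, add_dotProduct, smul_dotProduct,
    dotProduct_smul, smul_eq_mul, dotProduct_mulVec_symm hA v u]
  ring

/-- Second-order expansion of a quadratic function at `x`. -/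
lemma quadratic_expand {A : Matrix (Fin n) (Fin n) ℝ} (hA : A.IsSymm) (b x w : Fin n → ℝ) :
    (x + w) ⬝ᵥ A *ᵥ (x + w) + 2 * (b ⬝ᵥ (x + w)) =
      x ⬝ᵥ A *ᵥ x + 2 * (b ⬝ᵥ x) + 2 * (w ⬝ᵥ (A *ᵥ x + b)) + w ⬝ᵥ A *ᵥ w := by
  simp only [mulVec_add, dotProduct_add, add_dotProduct, dotProduct_mulVec_symm hA x w,
    dotProduct_comm b w]
  ring

lemma qf0_add {A0 : Matrix (Fin n) (Fin n) ℝ} (hA0 : A0.IsSymm) (b0 x w : Fin n → ℝ) :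
    qf0 A0 b0 (x + w) = qf0 A0 b0 x + 2 * (w ⬝ᵥ (A0 *ᵥ x + b0)) + w ⬝ᵥ A0 *ᵥ w := by
  simp only [qf0, quadratic_expand hA0]

lemma qf1_add {A1 : Matrix (Fin n) (Fin n) ℝ} (hA1 : A1.IsSymm) (b1 : Fin n → ℝ) (c1 : ℝ)
    (x w : Fin n → ℝ) :
    qf1 A1 b1 c1 (x + w) =
      qf1 A1 b1 c1 x + 2 * (w ⬝ᵥ (A1 *ᵥ x + b1)) + w ⬝ᵥ A1 *ᵥ w := by
  simp only [qf1, quadratic_expand hA1]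
  ring

lemma quadForm_lagrangian (A0 A1 : Matrix (Fin n) (Fin n) ℝ) (α : ℝ) (v : Fin n → ℝ) :
    v ⬝ᵥ (A0 + α • A1) *ᵥ v = v ⬝ᵥ A0 *ᵥ v + α * (v ⬝ᵥ A1 *ᵥ v) := by
  simp [add_mulVec, smul_mulVec, dotProduct_add]

end QuadraticForms

section LocalMinimizers

variable {n : ℕ} {A0 A1 : Matrix (Fin n) (Fin n) ℝ} {b0 b1 : Fin n → ℝ} {c1 : ℝ}
  {x : Fin n → ℝ}

lemma eventually_poly_neg {a : ℝ} (ha : a < 0) (b c : ℝ) :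
    ∀ᶠ t in 𝓝[>] (0 : ℝ), a + b * t + c * t ^ 2 < 0 := by
  have hc : Continuous fun t : ℝ => a + b * t + c * t ^ 2 := by fun_prop
  have := hc.continuousAt (x := 0)
  exact nhdsWithin_le_nhds (this.eventually_lt_const (by simpa using ha))

/-- Local minimality tested along the parabola `t ↦ x + t • p + t ^ 2 • q`. -/
lemma IsLocalMinGTR.eventually_le (h : IsLocalMinGTR A0 A1 b0 b1 c1 x) (p q : Fin n → ℝ) :
    ∀ᶠ t in 𝓝[>] (0 : ℝ), qf1 A1 b1 c1 (x + (t • p + t ^ 2 • q)) ≤ 0 →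
      qf0 A0 b0 x ≤ qf0 A0 b0 (x + (t • p + t ^ 2 • q)) := by
  obtain ⟨-, δ, hδ, hmin⟩ := h
  have hc : Continuous fun t : ℝ => euclNorm (t • p + t ^ 2 • q) := by
    unfold euclNorm dotProduct
    simp only [Pi.add_apply, Pi.smul_apply, smul_eq_mul]
    fun_prop
  have h0 := (hc.continuousAt (x := 0)).eventually_lt_const (u := δ)
    (by simpa [euclNorm] using hδ)
  filter_upwards [nhdsWithin_le_nhds h0] with t ht hf
  exact hmin _ hf (by simpa using ht)

/-- A descent direction cannot be strictly feasible to first order. -/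
lemma IsLocalMinGTR.dotProduct_grad_nonneg (hA0 : A0.IsSymm) (hA1 : A1.IsSymm)
    (h : IsLocalMinGTR A0 A1 b0 b1 c1 x) {p : Fin n → ℝ}
    (hp : p ⬝ᵥ (A1 *ᵥ x + b1) < 0) : 0 ≤ p ⬝ᵥ (A0 *ᵥ x + b0) := by
  by_contra! hr
  obtain ⟨t, ht, h1, h2, h3⟩ := (eventually_mem_nhdsWithin.and
    ((eventually_poly_neg (mul_neg_of_pos_of_neg two_pos hp) (p ⬝ᵥ A1 *ᵥ p) 0).and
    ((eventually_poly_neg (mul_neg_of_pos_of_neg two_pos hr) (p ⬝ᵥ A0 *ᵥ p) 0).and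
      (h.eventually_le p 0)))).exists
  have ht : 0 < t := ht
  rw [qf1_add hA1, qf0_add hA0] at h3
  simp only [smul_zero, add_zero, mulVec_smul, smul_dotProduct, dotProduct_smul,
    smul_eq_mul] at h3
  have := h3 (by nlinarith [h.1])
  nlinarith

/-- First-order conditions at a boundary point where the constraint gradient is nonzero. -/
lemma IsLocalMinGTR.exists_multiplier (hA0 : A0.IsSymm) (hA1 : A1.IsSymm)
    (h : IsLocalMinGTR A0 A1 b0 b1 c1 x) (hg : A1 *ᵥ x + b1 ≠ 0) :
    ∃ α : ℝ, 0 ≤ α ∧ A0 *ᵥ x + b0 = -α • (A1 *ᵥ x + b1) := by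
  have key := fun p => h.dotProduct_grad_nonneg hA0 hA1 (p := p)
  set g := A1 *ᵥ x + b1
  set r := A0 *ᵥ x + b0
  have hgg : 0 < g ⬝ᵥ g := by simpa using dotProduct_star_self_pos_iff.2 hg
  have h1 := key (-g) (by simpa using hgg)
  have hgr : g ⬝ᵥ r ≤ 0 := by simpa using h1
  refine ⟨-(g ⬝ᵥ r) / (g ⬝ᵥ g), div_nonneg (by linarith) hgg.le, ?_⟩
  set α := -(g ⬝ᵥ r) / (g ⬝ᵥ g) with hα
  have hα' : α * (g ⬝ᵥ g) = -(g ⬝ᵥ r) := by rw [hα]; field_simp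
  have hsg : (r + α • g) ⬝ᵥ g = 0 := by
    rw [add_dotProduct, smul_dotProduct, smul_eq_mul, hα', dotProduct_comm r g]; ring
  have hss : (r + α • g) ⬝ᵥ r = (r + α • g) ⬝ᵥ (r + α • g) := by
    conv_rhs => rw [dotProduct_add, dotProduct_smul, hsg]
    simp
  have hle : (r + α • g) ⬝ᵥ (r + α • g) ≤ 0 := by
    refine le_of_forall_pos_le_add fun ε hε => ?_
    have hη : 0 < ε / (1 - g ⬝ᵥ r) := div_pos hε (by linarith)
    have := key (-(r + α • g) - (ε / (1 - g ⬝ᵥ r)) • g) (by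
      rw [sub_dotProduct, neg_dotProduct, hsg, smul_dotProduct, smul_eq_mul]
      nlinarith [mul_pos hη hgg])
    rw [sub_dotProduct, neg_dotProduct, hss, smul_dotProduct, smul_eq_mul] at this
    have he : ε / (1 - g ⬝ᵥ r) * (1 - g ⬝ᵥ r) = ε := div_mul_cancel₀ _ (by linarith)
    nlinarith
  have hs : r + α • g = 0 := by
    by_contra hne
    have : 0 < (r + α • g) ⬝ᵥ (r + α • g) := by
      simpa using dotProduct_star_self_pos_iff.2 hne
    linarith
  rw [neg_smul]
  exact eq_neg_of_add_eq_zero_left hs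

/-- Second-order necessary condition on the tangent space of the constraint. -/
lemma IsLocalMinGTR.second_order (hA0 : A0.IsSymm) (hA1 : A1.IsSymm)
    (h : IsLocalMinGTR A0 A1 b0 b1 c1 x) (hg : A1 *ᵥ x + b1 ≠ 0) {α : ℝ} (hα : 0 ≤ α)
    (hr : A0 *ᵥ x + b0 = -α • (A1 *ᵥ x + b1)) {p : Fin n → ℝ}
    (hp : p ⬝ᵥ (A1 *ᵥ x + b1) = 0) : 0 ≤ p ⬝ᵥ (A0 + α • A1) *ᵥ p := by
  by_contra! hneg
  rw [quadForm_lagrangian] at hneg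
  have hgg : 0 < (A1 *ᵥ x + b1) ⬝ᵥ (A1 *ᵥ x + b1) := by
    simpa using dotProduct_star_self_pos_iff.2 hg
  set g := A1 *ᵥ x + b1 with hgdef
  obtain ⟨ε, hε, hε'⟩ : ∃ ε > 0, p ⬝ᵥ A0 *ᵥ p + α * (p ⬝ᵥ A1 *ᵥ p) + α * ε < 0 := by
    refine ⟨-(p ⬝ᵥ A0 *ᵥ p + α * (p ⬝ᵥ A1 *ᵥ p)) / (α + 1),
      div_pos (by linarith) (by linarith), ?_⟩
    have h1 : 0 < α + 1 := by linarith
    have : p ⬝ᵥ A0 *ᵥ p + α * (p ⬝ᵥ A1 *ᵥ p) +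
        α * (-(p ⬝ᵥ A0 *ᵥ p + α * (p ⬝ᵥ A1 *ᵥ p)) / (α + 1)) =
        (p ⬝ᵥ A0 *ᵥ p + α * (p ⬝ᵥ A1 *ᵥ p)) / (α + 1) := by
      field_simp; ring
    rw [this]
    exact div_neg_of_neg_of_pos hneg h1
  set κ := -(p ⬝ᵥ A1 *ᵥ p + ε) / (2 * (g ⬝ᵥ g)) with hκ
  have hκ' : 2 * κ * (g ⬝ᵥ g) = -(p ⬝ᵥ A1 *ᵥ p + ε) := by rw [hκ]; field_simp
  set q := κ • g with hq
  have hqg : 2 * (q ⬝ᵥ g) = -(p ⬝ᵥ A1 *ᵥ p + ε) := by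
    rw [hq, smul_dotProduct, smul_eq_mul, ← hκ']; ring
  obtain ⟨t, ht, h1, h2, h3⟩ := (eventually_mem_nhdsWithin.and
    ((eventually_poly_neg (neg_neg_of_pos hε) (2 * (p ⬝ᵥ A1 *ᵥ q)) (q ⬝ᵥ A1 *ᵥ q)).and
    ((eventually_poly_neg hε' (2 * (p ⬝ᵥ A0 *ᵥ q)) (q ⬝ᵥ A0 *ᵥ q)).and
      (h.eventually_le p q)))).exists
  have ht : 0 < t := ht
  rw [qf1_add hA1, qf0_add hA0, quadForm_comb hA0, quadForm_comb hA1, hr, ← hgdef] at h3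
  simp only [add_dotProduct, smul_dotProduct, dotProduct_smul, smul_eq_mul, hp] at h3
  have ht2 : 0 < t ^ 2 := by positivity
  have h4 := mul_neg_of_pos_of_neg ht2 h1
  have h5 := mul_neg_of_pos_of_neg ht2 h2
  have hqg' : q ⬝ᵥ g = -(p ⬝ᵥ A1 *ᵥ p + ε) / 2 := by linarith
  rw [hqg'] at h3
  have := h3 (by nlinarith [h.1])
  nlinarith

/-- Curvature is nonnegative along a line that is feasible near the local minimizer. -/
lemma IsLocalMinGTR.line_feasible (hA0 : A0.IsSymm) (h : IsLocalMinGTR A0 A1 b0 b1 c1 x)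
    {p : Fin n → ℝ} (hpos : ∀ᶠ t in 𝓝[>] (0 : ℝ), qf1 A1 b1 c1 (x + t • p) ≤ 0)
    (hneg : ∀ᶠ t in 𝓝[>] (0 : ℝ), qf1 A1 b1 c1 (x + t • (-p)) ≤ 0) :
    p ⬝ᵥ (A0 *ᵥ x + b0) = 0 ∧ 0 ≤ p ⬝ᵥ A0 *ᵥ p := by
  have hle : ∀ v : Fin n → ℝ, (∀ᶠ t in 𝓝[>] (0 : ℝ), qf1 A1 b1 c1 (x + t • v) ≤ 0) →
      ∀ᶠ t in 𝓝[>] (0 : ℝ),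
        0 ≤ t * (2 * (v ⬝ᵥ (A0 *ᵥ x + b0)) + (v ⬝ᵥ A0 *ᵥ v) * t) := by
    intro v hv
    filter_upwards [hv, h.eventually_le v 0] with t h1 h2
    simp only [smul_zero, add_zero] at h2
    have := h2 h1
    rw [qf0_add hA0] at this
    simp only [mulVec_smul, smul_dotProduct, dotProduct_smul, smul_eq_mul] at this
    linarith
  have hfirst : ∀ v : Fin n → ℝ, (∀ᶠ t in 𝓝[>] (0 : ℝ), qf1 A1 b1 c1 (x + t • v) ≤ 0) →
      0 ≤ v ⬝ᵥ (A0 *ᵥ x + b0) := by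
    intro v hv
    by_contra! hr
    obtain ⟨t, ht, h1, h2⟩ := (eventually_mem_nhdsWithin.and
      ((eventually_poly_neg (mul_neg_of_pos_of_neg two_pos hr) (v ⬝ᵥ A0 *ᵥ v) 0).and
      (hle v hv))).exists
    have ht : 0 < t := ht
    nlinarith
  have hz : p ⬝ᵥ (A0 *ᵥ x + b0) = 0 := by
    have h1 := hfirst p hpos
    have h2 := hfirst (-p) hneg
    rw [neg_dotProduct] at h2
    linarith
  refine ⟨hz, ?_⟩
  obtain ⟨t, ht, h1⟩ := (eventually_mem_nhdsWithin.and (hle p hpos)).exists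
  have ht : 0 < t := ht
  rw [hz] at h1
  by_contra! hc
  nlinarith [mul_pos ht ht]

/-- Optimality conditions satisfied by a local-nonglobal minimizer. -/
lemma IsLNGMinGTR.optimality (hA0 : A0.IsSymm) (hA1 : A1.IsSymm)
    (h : IsLNGMinGTR A0 A1 b0 b1 c1 x) :
    qf1 A1 b1 c1 x = 0 ∧ ∃ α : ℝ, A0 *ᵥ x + b0 = -α • (A1 *ᵥ x + b1) ∧
      (∀ p, p ⬝ᵥ (A1 *ᵥ x + b1) = 0 → 0 ≤ p ⬝ᵥ (A0 + α • A1) *ᵥ p) ∧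
      ∃ u, u ⬝ᵥ (A0 + α • A1) *ᵥ u < 0 := by
  obtain ⟨hloc, hng⟩ := h
  have hglob : ¬ ∀ w : Fin n → ℝ, qf1 A1 b1 c1 (x + w) ≤ 0 →
      0 ≤ 2 * (w ⬝ᵥ (A0 *ᵥ x + b0)) + w ⬝ᵥ A0 *ᵥ w := by
    refine fun H => hng ⟨hloc.1, fun z hz => ?_⟩
    have h1 := H (z - x) (by simpa using hz)
    have h2 := qf0_add hA0 b0 x (z - x)
    rw [add_sub_cancel] at h2
    linarith
  have hzero : qf1 A1 b1 c1 x = 0 := by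
    by_contra hne
    have hlt := lt_of_le_of_ne hloc.1 hne
    have hfeas : ∀ v : Fin n → ℝ, ∀ᶠ t in 𝓝[>] (0 : ℝ), qf1 A1 b1 c1 (x + t • v) ≤ 0 := by
      intro v
      filter_upwards [eventually_poly_neg hlt (2 * (v ⬝ᵥ (A1 *ᵥ x + b1))) (v ⬝ᵥ A1 *ᵥ v)]
        with t ht
      rw [qf1_add hA1]
      simp only [mulVec_smul, smul_dotProduct, dotProduct_smul, smul_eq_mul]
      linarith
    refine hglob fun w _ => ?_
    obtain ⟨h1, h2⟩ := hloc.line_feasible hA0 (hfeas w) (hfeas (-w))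
    rw [h1]
    linarith
  have hg : A1 *ᵥ x + b1 ≠ 0 := by
    intro hg
    have hexp : ∀ v, qf1 A1 b1 c1 (x + v) = v ⬝ᵥ A1 *ᵥ v := by
      intro v
      rw [qf1_add hA1, hzero, hg]
      simp
    have hfeas : ∀ v : Fin n → ℝ, v ⬝ᵥ A1 *ᵥ v ≤ 0 →
        ∀ᶠ t in 𝓝[>] (0 : ℝ), qf1 A1 b1 c1 (x + t • v) ≤ 0 := by
      intro v hv
      refine Eventually.of_forall fun t => ?_
      rw [hexp]
      simp only [mulVec_smul, smul_dotProduct, dotProduct_smul, smul_eq_mul]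
      nlinarith [mul_self_nonneg t]
    refine hglob fun w hw => ?_
    rw [hexp] at hw
    obtain ⟨h1, h2⟩ := hloc.line_feasible hA0 (hfeas w hw)
      (hfeas (-w) (by simpa [mulVec_neg] using hw))
    rw [h1]
    linarith
  obtain ⟨α, hα, hr⟩ := hloc.exists_multiplier hA0 hA1 hg
  refine ⟨hzero, α, hr, fun p hp => hloc.second_order hA0 hA1 hg hα hr hp, ?_⟩
  by_contra! hpsd
  refine hglob fun w hw => ?_
  have h1 := hpsd w
  rw [quadForm_lagrangian] at h1
  rw [qf1_add hA1, hzero] at hw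
  rw [hr, dotProduct_smul, smul_eq_mul]
  nlinarith

end LocalMinimizers

/-- Two distinct boundary points cannot both satisfy the stationarity and curvature conditions
of a local-nonglobal minimizer, when the multiplier `β` of `y` is at least as close to the
negative definite parameter `μ` as the multiplier `α` of `x`. -/
lemma eq_of_optimality {n : ℕ} {A0 A1 : Matrix (Fin n) (Fin n) ℝ} (hA0 : A0.IsSymm)
    (hA1 : A1.IsSymm) {b0 b1 : Fin n → ℝ} {c1 μ α β : ℝ}
    (hμ : ∀ v : Fin n → ℝ, v ≠ 0 → v ⬝ᵥ A0 *ᵥ v + μ * (v ⬝ᵥ A1 *ᵥ v) < 0)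
    {x y : Fin n → ℝ} (hxy : qf1 A1 b1 c1 x = qf1 A1 b1 c1 y)
    (hx : A0 *ᵥ x + b0 = -α • (A1 *ᵥ x + b1)) (hy : A0 *ᵥ y + b0 = -β • (A1 *ᵥ y + b1))
    (hxp : ∀ p, p ⬝ᵥ (A1 *ᵥ x + b1) = 0 → 0 ≤ p ⬝ᵥ (A0 + α • A1) *ᵥ p)
    (hyp : ∀ p, p ⬝ᵥ (A1 *ᵥ y + b1) = 0 → 0 ≤ p ⬝ᵥ (A0 + β • A1) *ᵥ p)
    (hu : ∃ u, u ⬝ᵥ (A0 + α • A1) *ᵥ u < 0) (hle : (β - μ) ^ 2 ≤ (α - μ) ^ 2) : x = y := by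
  by_contra hne
  obtain ⟨u, hu⟩ := hu
  obtain ⟨d, rfl⟩ : ∃ d, y = x + d := ⟨y - x, by simp⟩
  have hd : d ≠ 0 := by rintro rfl; simp at hne
  have hQs : (A0 + α • A1).IsSymm := hA0.add (hA1.smul α)
  have hRs : (A0 + β • A1).IsSymm := hA0.add (hA1.smul β)
  set g := A1 *ᵥ x + b1 with hg
  set h := A1 *ᵥ (x + d) + b1 with hh
  have hA1d : A1 *ᵥ d = h - g := by rw [hg, hh, mulVec_add]; abel
  have hA0d : A0 *ᵥ d = α • g - β • h := by
    rw [neg_smul] at hx hy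
    have : A0 *ᵥ d = (A0 *ᵥ (x + d) + b0) - (A0 *ᵥ x + b0) := by rw [mulVec_add]; abel
    rw [this, hx, hy]; abel
  have hQd : (A0 + α • A1) *ᵥ d = (α - β) • h := by
    rw [add_mulVec, smul_mulVec, hA0d, hA1d]; module
  have hRd : (A0 + β • A1) *ᵥ d = (α - β) • g := by
    rw [add_mulVec, smul_mulVec, hA0d, hA1d]; module
  have hdg : d ⬝ᵥ g = -(d ⬝ᵥ h) := by
    have := qf1_add hA1 b1 c1 x d
    rw [← hxy, ← hg, hA1d, dotProduct_sub] at this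
    linarith
  have hdμ : 0 < ((α - μ) + (β - μ)) * (d ⬝ᵥ h) := by
    have := hμ d hd
    rw [hA0d, hA1d] at this
    simp only [dotProduct_sub, dotProduct_smul, smul_eq_mul, hdg] at this
    linarith
  have hdh : d ⬝ᵥ h ≠ 0 := right_ne_zero_of_mul hdμ.ne'
  have hsum : (α - μ) + (β - μ) ≠ 0 := left_ne_zero_of_mul hdμ.ne'
  have hδ : 0 ≤ (α - β) * (d ⬝ᵥ h) := by
    have h1 : 0 ≤ ((α - β) * (d ⬝ᵥ h)) * ((α - μ) + (β - μ)) ^ 2 := by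
      nlinarith [mul_nonneg (sub_nonneg.2 hle) hdμ.le]
    exact nonneg_of_mul_nonneg_left h1 (by positivity)
  -- the `g`-tangential part of the negative direction `u`
  set w := (d ⬝ᵥ g) • u + (-(u ⬝ᵥ g)) • d with hw
  have hwg : w ⬝ᵥ g = 0 := by
    rw [hw]; simp only [add_dotProduct, smul_dotProduct, smul_eq_mul]; ring
  have hgg : 0 < (d ⬝ᵥ g) ^ 2 := by
    rw [hdg, neg_sq]
    positivity
  rcases eq_or_ne α β with rfl | hαβ
  · have h1 := hxp w hwg
    rw [hw, quadForm_comb hQs, hQd] at h1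
    simp at h1
    nlinarith
  have hδ' : 0 < (α - β) * (d ⬝ᵥ h) :=
    lt_of_le_of_ne hδ (mul_ne_zero (sub_ne_zero.2 hαβ) hdh).symm
  have hQ : ∀ v, v ⬝ᵥ (A0 + α • A1) *ᵥ v =
      v ⬝ᵥ A0 *ᵥ v + μ * (v ⬝ᵥ A1 *ᵥ v) + (α - μ) * (v ⬝ᵥ A1 *ᵥ v) := by
    intro v; rw [quadForm_lagrangian]; ring
  have hR : ∀ v, v ⬝ᵥ (A0 + β • A1) *ᵥ v =
      v ⬝ᵥ A0 *ᵥ v + μ * (v ⬝ᵥ A1 *ᵥ v) + (β - μ) * (v ⬝ᵥ A1 *ᵥ v) := by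
    intro v; rw [quadForm_lagrangian]; ring
  have hμ0 : ∀ v : Fin n → ℝ, v ⬝ᵥ A0 *ᵥ v + μ * (v ⬝ᵥ A1 *ᵥ v) ≤ 0 := by
    intro v
    rcases eq_or_ne v 0 with rfl | hv
    · simp
    · exact (hμ v hv).le
  have hlt : (β - μ) ^ 2 < (α - μ) ^ 2 := by
    have h1 : 0 < (α - β) * ((α - μ) + (β - μ)) * (d ⬝ᵥ h) ^ 2 := by
      nlinarith [mul_pos hδ' hdμ]
    nlinarith [pos_of_mul_pos_left h1 (sq_nonneg _)]
  rcases lt_or_ge 0 ((α - μ) * (β - μ)) with hs | hs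
  · set v := (d ⬝ᵥ h) • u + (-(u ⬝ᵥ h)) • d with hv
    have hvh : v ⬝ᵥ h = 0 := by
      rw [hv]; simp only [add_dotProduct, smul_dotProduct, smul_eq_mul]; ring
    have h1 := hyp v hvh
    have h2 : v ⬝ᵥ (A0 + α • A1) *ᵥ v < 0 := by
      rw [hv, quadForm_comb hQs, hQd]
      simp only [dotProduct_smul, smul_eq_mul]
      have := mul_neg_of_pos_of_neg (pow_pos (abs_pos.2 hdh) 2) hu
      rw [sq_abs] at this
      nlinarith [mul_nonneg hδ'.le (sq_nonneg (u ⬝ᵥ h))]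
    rw [hR] at h1
    rw [hQ] at h2
    have h3 := hμ0 v
    set m := v ⬝ᵥ A0 *ᵥ v + μ * (v ⬝ᵥ A1 *ᵥ v)
    set k := v ⬝ᵥ A1 *ᵥ v
    have h4 : 0 ≤ (α - μ) * (β - μ) * (m + (β - μ) * k) := mul_nonneg hs.le h1
    have h5 : (β - μ) ^ 2 * (m + (α - μ) * k) < 0 :=
      mul_neg_of_pos_of_neg (by
        have : β - μ ≠ 0 := right_ne_zero_of_mul hs.ne'
        positivity) h2
    have h6 : 0 ≤ ((β - μ) ^ 2 - (α - μ) * (β - μ)) * m := by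
      refine mul_nonneg_of_nonpos_of_nonpos ?_ h3
      nlinarith [sq_nonneg (α - β)]
    nlinarith
  · have hw0 : w ≠ 0 := by
      intro h0
      have h1 : (d ⬝ᵥ g) • u = (u ⬝ᵥ g) • d := by
        rw [hw, neg_smul] at h0
        exact add_neg_eq_zero.1 h0
      have h2 : (d ⬝ᵥ g) ^ 2 * (u ⬝ᵥ (A0 + α • A1) *ᵥ u) =
          (u ⬝ᵥ g) ^ 2 * ((α - β) * (d ⬝ᵥ h)) := by
        have := congrArg (fun z => z ⬝ᵥ (A0 + α • A1) *ᵥ z) h1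
        simp only [mulVec_smul, smul_dotProduct, dotProduct_smul, smul_eq_mul, hQd] at this
        linarith
      nlinarith [mul_neg_of_pos_of_neg hgg hu, mul_nonneg (sq_nonneg (u ⬝ᵥ g)) hδ]
    have h1 := hxp w hwg
    have h2 := hμ w hw0
    rw [hQ] at h1
    have h3 : w ⬝ᵥ (A0 + β • A1) *ᵥ w < 0 := by
      rw [hR]
      have h4 : 0 < (α - μ) * (w ⬝ᵥ A1 *ᵥ w) := by linarith
      have h5 : (β - μ) * (w ⬝ᵥ A1 *ᵥ w) ≤ 0 := by
        have h6 : 0 < (α - μ) ^ 2 := by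
          have : α - μ ≠ 0 := left_ne_zero_of_mul h4.ne'
          positivity
        refine nonpos_of_mul_nonpos_right (a := (α - μ) ^ 2) ?_ h6
        nlinarith [mul_nonneg (neg_nonneg.2 hs) h4.le]
      linarith
    have h4 := hyp ((d ⬝ᵥ h) • w + (-(w ⬝ᵥ h)) • d) (by
      simp only [add_dotProduct, smul_dotProduct, smul_eq_mul]; ring)
    rw [quadForm_comb hRs, hRd] at h4
    simp only [dotProduct_smul, smul_eq_mul, hwg, hdg] at h4
    have h5 := mul_neg_of_pos_of_neg (pow_pos (abs_pos.2 hdh) 2) h3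
    rw [sq_abs] at h5
    nlinarith [mul_nonneg hδ'.le (sq_nonneg (w ⬝ᵥ h))]

theorem stmt18 {n : ℕ} (hn : 1 ≤ n)
    (A0 A1 : Matrix (Fin n) (Fin n) ℝ) (hA0 : A0.IsSymm) (hA1 : A1.IsSymm)
    (b0 b1 : Fin n → ℝ) (c1 : ℝ)
    (hjoint : ∃ μ1 : ℝ, (-(A0 + μ1 • A1)).PosDef) :
    ∀ x y : Fin n → ℝ, IsLNGMinGTR A0 A1 b0 b1 c1 x →
      IsLNGMinGTR A0 A1 b0 b1 c1 y → x = y := by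
  obtain ⟨μ, hμ⟩ := hjoint
  have hneg : ∀ v : Fin n → ℝ, v ≠ 0 → v ⬝ᵥ A0 *ᵥ v + μ * (v ⬝ᵥ A1 *ᵥ v) < 0 := by
    intro v hv
    have := hμ.dotProduct_mulVec_pos hv
    rw [star_trivial, neg_mulVec, dotProduct_neg, quadForm_lagrangian] at this
    linarith
  intro x y hx hy
  obtain ⟨hx0, α, hxs, hxp, hxu⟩ := hx.optimality hA0 hA1
  obtain ⟨hy0, β, hys, hyp, hyu⟩ := hy.optimality hA0 hA1
  rcases le_total ((β - μ) ^ 2) ((α - μ) ^ 2) with hle | hle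
  · exact eq_of_optimality hA0 hA1 hneg (hx0.trans hy0.symm) hxs hys hxp hyp hxu hle
  · exact (eq_of_optimality hA0 hA1 hneg (hy0.trans hx0.symm) hys hxs hyp hxp hyu hle).symm
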